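/- arXiv:0904.1948 — 2 statements merged into one kernel-verified Lean document; each statement's English description precedes it below -/
import Mathlib

section
/- For every A ⊆ L(Σ,k⃗) such that μ(A) = 1 for some idempotent μ ∈ θL(Σ,k⃗) that is minimal in θL(Σ,k⃗), there exists a sequence (wₙ)_{n∈ℕ} in L(Σ,k⃗;υ) with wₙ < wₙ₊₁ for every n ∈ ℕ such that T_{p₁}(w_{n₁}) ⋆ … ⋆ T_{p_λ}(w_{n_λ}) ∈ A for every λ ∈ ℕ, n₁ < … < n_λ ∈ ℕ and p₁,…,p_λ ∈ ℕ with 1 ≤ pᵢ ≤ k_{nᵢ} for every 1 ≤ i ≤ λ. -/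
namespace Farmaki

/-- A located word over the alphabet `Σ ∪ {υ}`: positions are natural numbers,
`none` means the position is not in the domain, `some 0` is the variable `υ`,
and `some a` for `a ≥ 1` is the letter `αₐ`. -/
abbrev LWord := ℕ → Option ℕ

/-- The domain of a located word. -/
def dom (w : LWord) : Set ℕ := {n | w n ≠ none}

/-- `min dom(w)`. -/
noncomputable def minDom (w : LWord) : ℕ := sInf (dom w)

/-- A variable ω-located word over `Σ` dominated by `k`. -/
def IsVarWord (k : ℕ → ℕ) (w : LWord) : Prop :=
  (dom w).Finite ∧ (dom w).Nonempty ∧ (∀ n a, w n = some a → a ≤ k n) ∧ ∃ n, w n = some 0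

/-- A (constant) ω-located word over `Σ` dominated by `k`. -/
def IsConstWord (k : ℕ → ℕ) (w : LWord) : Prop :=
  (dom w).Finite ∧ (dom w).Nonempty ∧ ∀ n a, w n = some a → 1 ≤ a ∧ a ≤ k n

/-- `w < u` iff `max dom(w) < min dom(u)`. -/
def wlt (w u : LWord) : Prop := ∀ m n, w m ≠ none → u n ≠ none → m < n

/-- Concatenation `w ⋆ u` of located words (union of graphs, `w` taking precedence). -/
def star (w u : LWord) : LWord := fun n => (w n).orElse (fun _ => u n)

/-- The empty located word. -/
def emptyW : LWord := fun _ => none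

/-- The substitution `T_p`: for `p ≥ 1` it replaces the variable `υ` at position `n`
by `α_p` if `k n ≥ p` and by `α_{k n}` otherwise; `T_0` is the identity. -/
def Tp (k : ℕ → ℕ) (p : ℕ) (w : LWord) : LWord := fun n =>
  match w n with
  | none => none
  | some a => if a = 0 ∧ p ≠ 0 then some (min p (k n)) else some a

/-- The combination `T_{p 0}(w (n 0)) ⋆ ⋯ ⋆ T_{p l}(w (n l))`. -/
def comb (k : ℕ → ℕ) (w : ℕ → LWord) {l : ℕ} (n p : Fin (l + 1) → ℕ) : LWord :=
  (List.ofFn fun i => Tp k (p i) (w (n i))).foldr star emptyW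

/-- `EV(w⃗)`: the extracted variable ω-located words of a sequence `w⃗`. -/
def EV (k : ℕ → ℕ) (w : ℕ → LWord) : Set LWord :=
  {u | ∃ (l : ℕ) (n p : Fin (l + 1) → ℕ), StrictMono n ∧
    (∀ i, p i ≤ k (n i)) ∧ (∃ i, p i = 0) ∧ u = comb k w n p}

/-- `E(w⃗)`: the extracted (constant) ω-located words of a sequence `w⃗`. -/
def Econst (k : ℕ → ℕ) (w : ℕ → LWord) : Set LWord :=
  {u | ∃ (l : ℕ) (n p : Fin (l + 1) → ℕ), StrictMono n ∧
    (∀ i, 1 ≤ p i ∧ p i ≤ k (n i)) ∧ u = comb k w n p}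

/-- An infinite orderly sequence of variable ω-located words, i.e. a member of
`L^∞(Σ,k⃗;υ)`. -/
def OrderlyVar (k : ℕ → ℕ) (w : ℕ → LWord) : Prop :=
  (∀ n, IsVarWord k (w n)) ∧ ∀ n, wlt (w n) (w (n + 1))

/-- `u⃗ ≺ w⃗`: `u⃗` is an extraction of `w⃗`. -/
def Extraction (k : ℕ → ℕ) (u w : ℕ → LWord) : Prop :=
  OrderlyVar k u ∧ ∀ n, u n ∈ EV k w

/-- A finite orderly sequence of variable ω-located words, i.e. a member of
`L^{<∞}(Σ,k⃗;υ)` (the empty list is allowed). -/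
def FinOrderlyV (k : ℕ → ℕ) (ws : List LWord) : Prop :=
  (∀ w ∈ ws, IsVarWord k w) ∧ ws.Chain' wlt

/-- A finite orderly sequence of (constant) ω-located words, i.e. a member of
`L^{<∞}(Σ,k⃗)` (the empty list is allowed). -/
def FinOrderlyC (k : ℕ → ℕ) (ws : List LWord) : Prop :=
  (∀ w ∈ ws, IsConstWord k w) ∧ ws.Chain' wlt

end Farmaki

namespace Farmaki

/-- The semigroup operation `w + u` on `L(Σ∪{υ},k⃗)`: the word with domain
`dom(w) ∪ dom(u)`, agreeing with `w` (resp. `u`) off `dom(u)` (resp. `dom(w)`), and at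
common positions taking `α_{max(μ,ν)}` if both letters are in `Σ`, and `υ` if either
letter is `υ`. -/
def plusW (w u : LWord) : LWord := fun q =>
  match w q, u q with
  | none, x => x
  | some a, none => some a
  | some a, some b => if a = 0 ∨ b = 0 then some 0 else some (max a b)

/-- `SumEq μ₁ μ₂ ν` says that `μ₁ + μ₂ = ν` in `βX`, where
`(μ₁ + μ₂)(A) = μ₁({x : μ₂({y : x + y ∈ A}) = 1})`. -/
def SumEq (μ₁ μ₂ ν : Ultrafilter LWord) : Prop :=
  ∀ A : Set LWord, A ∈ ν ↔ {x | {y | plusW x y ∈ A} ∈ μ₂} ∈ μ₁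

/-- `μ` is an idempotent ultrafilter: `μ + μ = μ`. -/
def IsIdem (μ : Ultrafilter LWord) : Prop := SumEq μ μ μ

/-- `θA = ⋂_{w ∈ L(Σ∪{υ},k⃗)} (A_w)*`, where `A_w = {u ∈ A : w < u}`. -/
def theta (k : ℕ → ℕ) (A : Set LWord) : Set (Ultrafilter LWord) :=
  {μ | ∀ w : LWord, (IsVarWord k w ∨ IsConstWord k w) → {u | u ∈ A ∧ wlt w u} ∈ μ}

/-- `μ` is an idempotent member of `S` which is minimal in `S`: every idempotent
`μ' ∈ S` with `μ' + μ = μ + μ' = μ'` equals `μ`. -/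
def MinimalIdemIn (S : Set (Ultrafilter LWord)) (μ : Ultrafilter LWord) : Prop :=
  μ ∈ S ∧ IsIdem μ ∧
    ∀ μ' ∈ S, IsIdem μ' → SumEq μ' μ μ' → SumEq μ μ' μ' → μ' = μ

attribute [local instance] Ultrafilter.add Ultrafilter.addSemigroup

lemma plusW_assoc (x y z : LWord) : plusW (plusW x y) z = plusW x (plusW y z) := by
  funext q
  simp only [plusW]
  rcases x q with _ | a <;> rcases y q with _ | b <;> rcases z q with _ | c <;> simp
  all_goals grind

lemma plusW_comm (x y : LWord) : plusW x y = plusW y x := by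
  funext q
  simp only [plusW]
  rcases x q with _ | a <;> rcases y q with _ | b <;> simp
  grind

instance : AddSemigroup LWord where
  add := plusW
  add_assoc := plusW_assoc

lemma sumEq_iff (μ₁ μ₂ ν : Ultrafilter LWord) : SumEq μ₁ μ₂ ν ↔ μ₁ + μ₂ = ν := by
  have key (A : Set LWord) : A ∈ μ₁ + μ₂ ↔ {x | {y | plusW x y ∈ A} ∈ μ₂} ∈ μ₁ :=
    Ultrafilter.eventually_add μ₁ μ₂ (· ∈ A)
  constructor
  · exact fun h => Ultrafilter.ext fun A => (key A).trans (h A).symm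
  · rintro rfl
    exact key

lemma plusW_eq_none {x y : LWord} {q : ℕ} : plusW x y q = none ↔ x q = none ∧ y q = none := by
  simp only [plusW]
  rcases x q with _ | a <;> rcases y q with _ | b <;> simp
  split_ifs <;> simp

lemma Tp_eq_none {k : ℕ → ℕ} {p : ℕ} {w : LWord} {q : ℕ} : Tp k p w q = none ↔ w q = none := by
  simp only [Tp]
  rcases w q with _ | a <;> simp
  split_ifs <;> simp

lemma dom_plusW (x y : LWord) : dom (plusW x y) = dom x ∪ dom y := by
  ext q
  simp only [dom, Set.mem_ofPred_eq, Set.mem_union, ne_eq, plusW_eq_none]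
  tauto

lemma dom_Tp (k : ℕ → ℕ) (p : ℕ) (w : LWord) : dom (Tp k p w) = dom w := by
  ext q
  simp only [dom, Set.mem_ofPred_eq, ne_eq, Tp_eq_none]

lemma wlt_plusW {w x y : LWord} (hx : wlt w x) (hy : wlt w y) : wlt w (plusW x y) := by
  intro m n hm hn
  rw [ne_eq, plusW_eq_none, not_and_or] at hn
  exact hn.elim (hx m n hm) (hy m n hm)

lemma wlt_Tp_left {k : ℕ → ℕ} {p : ℕ} {w u : LWord} : wlt (Tp k p w) u ↔ wlt w u := by
  simp only [wlt, ne_eq, Tp_eq_none]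

lemma wlt_Tp_right {k : ℕ → ℕ} {p : ℕ} {w u : LWord} : wlt w (Tp k p u) ↔ wlt w u := by
  simp only [wlt, ne_eq, Tp_eq_none]

lemma star_eq_plusW {x y : LWord} (h : wlt x y) : star x y = plusW x y := by
  funext q
  have := h q q
  simp only [star, plusW]
  rcases hx : x q with _ | a <;> rcases hy : y q with _ | b <;> simp_all

lemma star_emptyW (x : LWord) : star x emptyW = x := by
  funext q
  simp only [star, emptyW]
  rcases x q with _ | a <;> rfl

lemma Tp_plusW (k : ℕ → ℕ) (p : ℕ) {x y : LWord} (h : wlt x y) :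
    Tp k p (plusW x y) = plusW (Tp k p x) (Tp k p y) := by
  funext q
  have := h q q
  simp only [Tp, plusW]
  rcases hx : x q with _ | a <;> rcases hy : y q with _ | b <;> simp_all
  split_ifs <;> rfl

lemma IsConstWord.Tp_eq {k : ℕ → ℕ} {w : LWord} (h : IsConstWord k w) (p : ℕ) :
    Tp k p w = w := by
  funext q
  have := h.2.2 q
  simp only [Tp]
  rcases hw : w q with _ | a
  · rfl
  · have := this a hw
    simp only [ite_eq_right_iff]
    omega

lemma IsVarWord.isConstWord_Tp {k : ℕ → ℕ} (hk : ∀ n, 0 < k n) {w : LWord}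
    (h : IsVarWord k w) {p : ℕ} (hp : 1 ≤ p) : IsConstWord k (Tp k p w) := by
  refine ⟨by rw [dom_Tp]; exact h.1, by rw [dom_Tp]; exact h.2.1, fun n a ha => ?_⟩
  have hkn := hk n
  have hw := h.2.2.1 n
  simp only [Tp] at ha
  rcases hwn : w n with _ | b
  · simp [hwn] at ha
  · have := hw b hwn
    simp only [hwn] at ha
    split_ifs at ha <;> simp only [Option.some.injEq] at ha <;> omega

lemma IsVarWord.plusW {k : ℕ → ℕ} {x y : LWord} (hx : IsVarWord k x)
    (hy : IsVarWord k y ∨ IsConstWord k y) : IsVarWord k (plusW x y) := by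
  have hyf : (dom y).Finite := hy.elim (·.1) (·.1)
  have hyk : ∀ n a, y n = some a → a ≤ k n :=
    hy.elim (·.2.2.1) fun h n a ha => (h.2.2 n a ha).2
  refine ⟨by rw [dom_plusW]; exact hx.1.union hyf,
    by rw [dom_plusW]; exact hx.2.1.inl, fun n a ha => ?_, ?_⟩
  · have h1 := hx.2.2.1 n
    have h2 := hyk n
    simp only [Farmaki.plusW] at ha
    rcases hxn : x n with _ | b <;> rcases hyn : y n with _ | c <;> grind
  · obtain ⟨n, hn⟩ := hx.2.2.2
    refine ⟨n, ?_⟩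
    simp only [Farmaki.plusW, hn]
    rcases y n with _ | c <;> simp

/-- The located word whose only letter is the variable, at position `n`. -/
def varAt (n : ℕ) : LWord := fun q => if q = n then some 0 else none

lemma isVarWord_varAt (k : ℕ → ℕ) (n : ℕ) : IsVarWord k (varAt n) := by
  have hd : dom (varAt n) = {n} := by
    ext q
    simp [dom, varAt]
  refine ⟨by simp [hd], by simp [hd], fun q a h => ?_, n, by simp [varAt]⟩
  have : a = 0 := by
    simp only [varAt] at h
    split_ifs at h
    simpa using h.symm
  omega

lemma isClosed_theta (k : ℕ → ℕ) (A : Set LWord) : IsClosed (theta k A) := by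
  simp only [theta, Set.ofPred_forall]
  exact isClosed_iInter fun w => isClosed_iInter fun _ => ultrafilter_isClosed_basic _

lemma mem_of_mem_theta {k : ℕ → ℕ} {A : Set LWord} {μ : Ultrafilter LWord}
    (h : μ ∈ theta k A) : A ∈ μ :=
  Filter.mem_of_superset (h _ (.inl (isVarWord_varAt k 0))) fun _ hu => hu.1

lemma add_mem_theta {k : ℕ → ℕ} {A B C : Set LWord} {μ ν : Ultrafilter LWord}
    (hμ : μ ∈ theta k A) (hν : ν ∈ theta k B) (h : ∀ x ∈ A, ∀ y ∈ B, plusW x y ∈ C) :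
    μ + ν ∈ theta k C := by
  intro w hw
  refine (sumEq_iff μ ν _).2 rfl _ |>.2 ?_
  filter_upwards [hμ w hw] with x hx
  filter_upwards [hν w hw] with y hy
  exact ⟨h x hx.1 y hy.1, wlt_plusW hx.2 hy.2⟩

lemma map_Tp_mem_theta {k : ℕ → ℕ} (hk : ∀ n, 0 < k n) {ν : Ultrafilter LWord}
    (hν : ν ∈ theta k {w | IsVarWord k w}) {p : ℕ} (hp : 1 ≤ p) :
    ν.map (Tp k p) ∈ theta k {w | IsConstWord k w} := by
  intro w hw
  rw [Ultrafilter.mem_map]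
  filter_upwards [hν w hw] with u hu
  exact ⟨hu.1.isConstWord_Tp hk hp, wlt_Tp_right.2 hu.2⟩

lemma map_Tp_add {k : ℕ → ℕ} {A B : Set LWord} {μ ν : Ultrafilter LWord}
    (hA : ∀ w ∈ A, IsVarWord k w ∨ IsConstWord k w)
    (hμ : μ ∈ theta k A) (hν : ν ∈ theta k B) (p : ℕ) :
    (μ + ν).map (Tp k p) = μ.map (Tp k p) + ν.map (Tp k p) := by
  refine ((sumEq_iff _ _ _).1 fun C => ?_).symm
  rw [Ultrafilter.mem_map, (sumEq_iff μ ν _).2 rfl, Ultrafilter.mem_map]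
  refine Filter.eventually_congr (f := (μ : Filter LWord)) ?_
  filter_upwards [mem_of_mem_theta hμ] with x hx
  rw [Ultrafilter.mem_map]
  refine Filter.eventually_congr (f := (ν : Filter LWord)) ?_
  filter_upwards [hν x (hA x hx)] with y hy
  rw [Set.mem_preimage, Tp_plusW k p hy.2]

lemma map_Tp_of_mem_theta {k : ℕ → ℕ} {μ : Ultrafilter LWord}
    (hμ : μ ∈ theta k {w | IsConstWord k w}) (p : ℕ) : μ.map (Tp k p) = μ := by
  refine Ultrafilter.ext fun C => ?_
  rw [Ultrafilter.mem_map]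
  refine Filter.eventually_congr (f := (μ : Filter LWord)) ?_
  filter_upwards [mem_of_mem_theta hμ] with x hx
  change Tp k p x ∈ C ↔ x ∈ C
  rw [hx.Tp_eq p]

lemma theta_var_nonempty (k : ℕ → ℕ) : (theta k {w | IsVarWord k w}).Nonempty := by
  refine ⟨(Filter.hyperfilter ℕ).map varAt, fun w hw => ?_⟩
  have hfin : (dom w).Finite := hw.elim (·.1) (·.1)
  obtain ⟨b, hb⟩ := hfin.bddAbove
  rw [Ultrafilter.mem_map]
  have : ∀ᶠ n in (Filter.hyperfilter ℕ : Filter ℕ), b < n :=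
    Nat.hyperfilter_le_atTop (Filter.eventually_gt_atTop b)
  filter_upwards [this] with n hn
  refine ⟨isVarWord_varAt k n, fun m q hm hq => ?_⟩
  have hqn : q = n := by
    by_contra h
    simp [varAt, h] at hq
  exact hqn ▸ (hb hm).trans_lt hn

/-- Below every idempotent of `θL(Σ,k⃗)` there is an idempotent of `θL(Σ,k⃗;υ)`. -/
lemma exists_idempotent_var_le {k : ℕ → ℕ} {μ : Ultrafilter LWord}
    (hμ : μ ∈ theta k {w | IsConstWord k w}) (hidem : μ + μ = μ) :
    ∃ ν ∈ theta k {w | IsVarWord k w}, ν + ν = ν ∧ ν + μ = ν ∧ μ + ν = ν := by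
  set J := theta k {w | IsVarWord k w}
  have hJμ : ∀ j ∈ J, j + μ ∈ J := fun j hj =>
    add_mem_theta hj hμ fun x hx y hy => IsVarWord.plusW hx (.inr hy)
  have hμJ : ∀ j ∈ J, μ + j ∈ J := fun j hj =>
    add_mem_theta hμ hj fun x hx y hy => by
      rw [plusW_comm]
      exact IsVarWord.plusW hy (.inr hx)
  have hJJ : ∀ i ∈ J, ∀ j ∈ J, i + j ∈ J := fun i hi j hj =>
    add_mem_theta hi hj fun x hx y hy => IsVarWord.plusW hx (.inl hy)
  obtain ⟨ι, ⟨j, hj, rfl⟩, hι⟩ := exists_idempotent_in_compact_add_subsemigroup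
    Ultrafilter.continuous_add_left ((· + μ) '' J) ((theta_var_nonempty k).image _)
    ((isClosed_theta k _).isCompact.image (Ultrafilter.continuous_add_left μ))
    (by
      rintro _ ⟨i, hi, rfl⟩ _ ⟨j, hj, rfl⟩
      exact ⟨i + μ + j, hJJ _ (hJμ i hi) j hj, by simp only [add_assoc]⟩)
  have hιμ : j + μ + μ = j + μ := by rw [add_assoc, hidem]
  set ι := j + μ
  refine ⟨μ + ι, hμJ _ (hJμ j hj), ?_, ?_, ?_⟩
  · rw [add_assoc, ← add_assoc ι, hιμ, hι]
  · rw [add_assoc, hιμ]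
  · rw [← add_assoc, hidem]

/-- The elements of `B` that extend `w` to the right and remain in `B` after adding on the left
any admissible instance `T_p(w)`. -/
def nextSet (k : ℕ → ℕ) (n : ℕ) (w : LWord) (B : Set LWord) : Set LWord :=
  {y | y ∈ B ∧ wlt w y ∧ ∀ p, 1 ≤ p → p ≤ k n → plusW (Tp k p w) y ∈ B}

lemma exists_nextSet_mem {k : ℕ → ℕ} {μ ν : Ultrafilter LWord}
    (hμ : μ ∈ theta k {w | IsConstWord k w}) (hidem : μ + μ = μ)
    (hν : ν ∈ theta k {w | IsVarWord k w}) (hmap : ∀ p, 1 ≤ p → ν.map (Tp k p) = μ)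
    (n : ℕ) {B : Set LWord} (hB : B ∈ μ) :
    ∃ w, IsVarWord k w ∧ (∀ p, 1 ≤ p → p ≤ k n → Tp k p w ∈ B) ∧ nextSet k n w B ∈ μ := by
  have hB' : {x | x ∈ B ∧ {y | plusW x y ∈ B} ∈ μ} ∈ μ :=
    Filter.inter_mem hB (((sumEq_iff _ _ _).2 hidem B).1 hB)
  have hT : ∀ᶠ w in (ν : Filter LWord), ∀ p ∈ Set.Icc 1 (k n),
      Tp k p w ∈ {x | x ∈ B ∧ {y | plusW x y ∈ B} ∈ μ} := by
    rw [Filter.eventually_all_finite (Set.finite_Icc _ _)]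
    intro p hp
    rw [← hmap p hp.1, Ultrafilter.mem_map, hmap p hp.1] at hB'
    exact hB'
  obtain ⟨w, hw, hTw⟩ := (Filter.Eventually.and (mem_of_mem_theta hν) hT).exists
  refine ⟨w, hw, fun p h1 h2 => (hTw p ⟨h1, h2⟩).1, ?_⟩
  have hall : ∀ᶠ y in (μ : Filter LWord), ∀ p ∈ Set.Icc 1 (k n), plusW (Tp k p w) y ∈ B := by
    rw [Filter.eventually_all_finite (Set.finite_Icc _ _)]
    exact fun p hp => (hTw p hp).2
  filter_upwards [hB, hμ w (.inl hw), hall] with y h1 h2 h3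
  exact ⟨h1, h2.2, fun p hp hp' => h3 p ⟨hp, hp'⟩⟩

lemma antitone_of_eq_nextSet {k : ℕ → ℕ} {w : ℕ → LWord} {B : ℕ → Set LWord}
    (hB : ∀ n, B (n + 1) = nextSet k n (w n) (B n)) : Antitone B :=
  antitone_nat_of_succ_le fun n y hy => by
    rw [hB] at hy
    exact hy.1

lemma comb_mem {k : ℕ → ℕ} {w : ℕ → LWord} {B : ℕ → Set LWord}
    (hw : ∀ n p, 1 ≤ p → p ≤ k n → Tp k p (w n) ∈ B n)
    (hB : ∀ n, B (n + 1) = nextSet k n (w n) (B n))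
    {l : ℕ} (n p : Fin (l + 1) → ℕ) (hn : StrictMono n)
    (hp : ∀ i, 1 ≤ p i ∧ p i ≤ k (n i)) : comb k w n p ∈ B (n 0) := by
  induction l with
  | zero =>
    simp only [comb, List.ofFn_succ, List.ofFn_zero, List.foldr_cons, List.foldr_nil, star_emptyW]
    exact hw _ _ (hp 0).1 (hp 0).2
  | succ l ih =>
    have hrest := ih (fun i => n i.succ) (fun i => p i.succ)
      (hn.comp (Fin.strictMono_succ)) (fun i => hp i.succ)
    have hmem := antitone_of_eq_nextSet hB (Nat.succ_le_of_lt (hn (Fin.succ_pos 0))) hrest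
    rw [Nat.succ_eq_add_one, hB] at hmem
    have hcomb : comb k w n p = star (Tp k (p 0) (w (n 0)))
        (comb k w (fun i => n i.succ) (fun i => p i.succ)) := by
      simp only [comb]
      rw [List.ofFn_succ, List.foldr_cons]
    rw [hcomb, star_eq_plusW (wlt_Tp_left.2 hmem.2.1)]
    exact hmem.2.2 _ (hp 0).1 (hp 0).2

/-- **Corollary 1.3**: if `A ⊆ L(Σ,k⃗)` has `μ(A) = 1` for an idempotent
`μ ∈ θL(Σ,k⃗)` minimal in `θL(Σ,k⃗)`, then there is an infinite orderly sequence `(wₙ)`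
of variable ω-located words all of whose constant combinations lie in `A`. -/
theorem central_sets_located_words
    (k : ℕ → ℕ) (hk : ∀ n, 0 < k n)
    (A : Set LWord) (hA : ∀ w ∈ A, IsConstWord k w)
    (μ : Ultrafilter LWord)
    (hmin : MinimalIdemIn (theta k {w | IsConstWord k w}) μ)
    (hAμ : A ∈ μ) :
    ∃ w : ℕ → LWord, OrderlyVar k w ∧
      ∀ (l : ℕ) (n p : Fin (l + 1) → ℕ), StrictMono n →
        (∀ i, 1 ≤ p i ∧ p i ≤ k (n i)) → comb k w n p ∈ A := by
  obtain ⟨hμ, hidem, hmin⟩ := hmin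
  rw [IsIdem, sumEq_iff] at hidem
  obtain ⟨ν, hν, hνν, hνμ, hμν⟩ := exists_idempotent_var_le hμ hidem
  have hmap (p : ℕ) (hp : 1 ≤ p) : ν.map (Tp k p) = μ := by
    have hμp := map_Tp_of_mem_theta hμ p
    refine hmin _ (map_Tp_mem_theta hk hν hp) ?_ ?_ ?_
    · rw [IsIdem, sumEq_iff, ← map_Tp_add (fun _ h => .inl h) hν hν, hνν]
    · rw [sumEq_iff]
      nth_rw 1 [← hμp]
      rw [← map_Tp_add (fun _ h => .inl h) hν hμ, hνμ]
    · rw [sumEq_iff]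
      nth_rw 1 [← hμp]
      rw [← map_Tp_add (fun _ h => .inr h) hμ hν, hμν]
  choose f hfv hfT hfμ using fun (n : ℕ) (B : {B : Set LWord // B ∈ μ}) =>
    exists_nextSet_mem hμ hidem hν hmap n B.2
  let B : ℕ → {B : Set LWord // B ∈ μ} := fun n =>
    Nat.rec ⟨A, hAμ⟩ (fun n B => ⟨nextSet k n (f n B) B, hfμ n B⟩) n
  have hB (n : ℕ) : (B (n + 1)).1 = nextSet k n (f n (B n)) (B n).1 := rfl
  refine ⟨fun n => f n (B n), ⟨fun n => hfv n _, fun n => ?_⟩, fun l n p hn hp => ?_⟩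
  · have h := hfT (n + 1) (B (n + 1)) 1 le_rfl (hk _)
    rw [hB] at h
    exact wlt_Tp_right.1 h.2.1
  · exact antitone_of_eq_nextSet (B := fun n => (B n).1) hB (Nat.zero_le (n 0))
      (comb_mem (B := fun n => (B n).1) (fun n => hfT n (B n)) hB n p hn hp)

end Farmaki
end

section
/- Let k⃗ = (kₙ)_{n∈ℕ} be an increasing sequence of positive integers, w⃗ = (wₙ)_{n∈ℕ} ∈ L^∞(Σ,k⃗;υ) and r, s ∈ ℕ. If L(Σ,k⃗;υ) = A₁ ∪ … ∪ A_r and L(Σ,k⃗) = C₁ ∪ … ∪ C_s, then there exist an extraction u⃗ = (uₙ)_{n∈ℕ} of w⃗ and indices 1 ≤ i₀ ≤ r, 1 ≤ j₀ ≤ s such that EV(u⃗) ⊆ A_{i₀} and E(u⃗) ⊆ C_{j₀}. -/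
namespace Farmaki

section Auxiliary

open Filter Set

section CompactSemigroup

variable {S : Type*} [Semigroup S] [TopologicalSpace S]

theorem exists_minimal_closed_leftIdeal {K : Set S} (hK : IsCompact K) (hKc : IsClosed K)
    (hne : K.Nonempty) (hmul : ∀ x ∈ K, ∀ y ∈ K, x * y ∈ K) :
    ∃ N ⊆ K, Minimal (· ∈ {N : Set S | IsClosed N ∧ N.Nonempty ∧ N ⊆ K ∧
      ∀ x ∈ K, ∀ y ∈ N, x * y ∈ N}) N := by
  refine zorn_superset_nonempty _ (fun c hcs hc hcne => ?_) K ⟨hKc, hne, Subset.rfl, hmul⟩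
  obtain ⟨t₀, ht₀⟩ := hcne
  refine ⟨⋂₀ c, ⟨isClosed_sInter fun t ht => (hcs ht).1, ?_,
    (sInter_subset_of_mem ht₀).trans (hcs ht₀).2.2.1, fun x hx y hy => ?_⟩,
    fun s hs => sInter_subset_of_mem hs⟩
  · rw [sInter_eq_iInter]
    have : Nonempty c := ⟨⟨t₀, ht₀⟩⟩
    refine IsCompact.nonempty_iInter_of_directed_nonempty_isCompact_isClosed _
      (DirectedOn.directed_val (IsChain.directedOn hc.symm)) (fun i => (hcs i.2).2.1)
      (fun i => hK.of_isClosed_subset (hcs i.2).1 (hcs i.2).2.2.1) (fun i => (hcs i.2).1)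
  · exact mem_sInter.2 fun t ht => (hcs ht).2.2.2 x hx y (mem_sInter.1 hy t ht)

variable [T2Space S]

/-- A compact subsemigroup contains an idempotent that is minimal for the order
`t ≤ v ↔ t * v = t ∧ v * t = t`. -/
theorem exists_minimal_idempotent (hcont : ∀ r : S, Continuous (· * r)) {K : Set S}
    (hK : IsCompact K) (hne : K.Nonempty) (hmul : ∀ x ∈ K, ∀ y ∈ K, x * y ∈ K) :
    ∃ v ∈ K, v * v = v ∧ ∀ t ∈ K, t * t = t → t * v = t → v * t = t → t = v := by
  obtain ⟨N, hNK, hN⟩ := exists_minimal_closed_leftIdeal hK hK.isClosed hne hmul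
  obtain ⟨hNc, hNne, -, hNl⟩ := hN.prop
  obtain ⟨v, hv, hvv⟩ := exists_idempotent_in_compact_subsemigroup hcont N hNne
    (hK.of_isClosed_subset hNc hNK) (fun x hx y hy => hNl x (hNK hx) y hy)
  refine ⟨v, hNK hv, hvv, fun t ht htt htv hvt => ?_⟩
  have htN : t ∈ N := htv ▸ hNl t ht v hv
  have himg : (· * t) '' K = N := by
    refine hN.eq_of_subset ⟨(hK.image (hcont t)).isClosed, hne.image _, ?_, ?_⟩ ?_
    · rintro _ ⟨x, hx, rfl⟩
      exact hmul x hx t ht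
    · rintro x hx _ ⟨y, hy, rfl⟩
      exact ⟨x * y, hmul x hx y hy, mul_assoc _ _ _⟩
    · rintro _ ⟨x, hx, rfl⟩
      exact hNl x hx t htN
  obtain ⟨s, -, hs⟩ : v ∈ (· * t) '' K := himg ▸ hv
  have hs : s * t = v := hs
  rw [← hvt, ← hs, mul_assoc, htt]

/-- If `v` is an idempotent and the compact subsemigroup `I` is stable under multiplication by `v`,
then `I` contains an idempotent below `v`. -/
theorem exists_idempotent_le (hcont : ∀ r : S, Continuous (· * r)) {I : Set S}
    (hI : IsCompact I) (hne : I.Nonempty) (hmul : ∀ x ∈ I, ∀ y ∈ I, x * y ∈ I) {v : S}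
    (hvv : v * v = v) (hvI : ∀ x ∈ I, v * x ∈ I) (hIv : ∀ x ∈ I, x * v ∈ I) :
    ∃ u ∈ I, u * u = u ∧ u * v = u ∧ v * u = u := by
  obtain ⟨_, ⟨x, hx, rfl⟩, hxx⟩ := exists_idempotent_in_compact_subsemigroup hcont ((· * v) '' I)
    (hne.image _) (hI.image (hcont v)) (by
      rintro _ ⟨x, hx, rfl⟩ _ ⟨y, hy, rfl⟩
      exact ⟨x * v * y, hmul _ (hIv x hx) y hy, mul_assoc _ _ _⟩)
  have hxx : x * v * (x * v) = x * v := hxx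
  refine ⟨v * (x * v), hvI _ (hIv x hx), ?_, ?_, ?_⟩
  · calc v * (x * v) * (v * (x * v)) = v * (x * (v * v) * (x * v)) := by simp only [mul_assoc]
      _ = v * (x * v) := by rw [hvv, hxx]
  · rw [mul_assoc, mul_assoc, hvv]
  · rw [← mul_assoc, hvv]

end CompactSemigroup

section Ultrafilter

attribute [local instance] Ultrafilter.mul Ultrafilter.semigroup

variable {M : Type*}

/-- The ultrafilters containing every member of a sequence of sets. -/
def ultraOf (F : ℕ → Set M) : Set (Ultrafilter M) := {U | ∀ m, F m ∈ U}

theorem isCompact_ultraOf (F : ℕ → Set M) : IsCompact (ultraOf F) := by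
  have : ultraOf F = ⋂ m, {U : Ultrafilter M | F m ∈ U} := by ext; simp [ultraOf]
  rw [this]
  exact (isClosed_iInter fun m => ultrafilter_isClosed_basic (F m)).isCompact

theorem ultraOf_nonempty {F : ℕ → Set M} (hF : Antitone F) (hne : ∀ m, (F m).Nonempty) :
    (ultraOf F).Nonempty := by
  have : (⨅ m, 𝓟 (F m)).NeBot := by
    refine iInf_neBot_of_directed' (fun i j => ⟨max i j, ?_, ?_⟩)
      fun m => principal_neBot_iff.2 (hne m)
    · exact principal_mono.2 (hF (le_max_left i j))
    · exact principal_mono.2 (hF (le_max_right i j))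
  exact ⟨Ultrafilter.of (⨅ m, 𝓟 (F m)), fun m =>
    Ultrafilter.of_le _ (mem_iInf_of_mem m (mem_principal_self _))⟩

variable [Semigroup M]

theorem mul_mem_ultraOf {F G H : ℕ → Set M}
    (h : ∀ m, ∀ x ∈ F m, ∃ m', ∀ y ∈ G m', x * y ∈ H m) {U V : Ultrafilter M}
    (hU : U ∈ ultraOf F) (hV : V ∈ ultraOf G) : U * V ∈ ultraOf H := by
  intro m
  refine (Ultrafilter.eventually_mul U V (· ∈ H m)).2 ?_
  filter_upwards [hU m] with x hx
  obtain ⟨m', hm'⟩ := h m x hx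
  filter_upwards [hV m'] with y hy using hm' y hy

theorem ultrafilter_map_mul (T : M →ₙ* M) (U V : Ultrafilter M) :
    (U * V).map T = U.map T * V.map T := by
  refine Ultrafilter.coe_inj.mp (Filter.ext' fun p => ?_)
  rw [Ultrafilter.eventually_mul]
  change (∀ᶠ x in ↑(U * V), p (T x)) ↔ ∀ᶠ x in U, ∀ᶠ y in V, p (T x * T y)
  simp [Ultrafilter.eventually_mul]

/-- Tails of constant and of variable words in an abstract semigroup of words, with
substitutions `T p` that are admissible on the `n`-th tail for `p ≤ k n`. -/
structure WordTails (k : ℕ → ℕ) (T : ℕ → M →ₙ* M) (L V : ℕ → Set M) : Prop where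
  antitone_const : Antitone L
  antitone_var : Antitone V
  nonempty_const : ∀ m, (L m).Nonempty
  nonempty_var : ∀ m, (V m).Nonempty
  mul_const_const : ∀ m, ∀ x ∈ L m, ∃ m', ∀ y ∈ L m', x * y ∈ L m
  mul_const_var : ∀ m, ∀ x ∈ L m, ∃ m', ∀ y ∈ V m', x * y ∈ V m
  mul_var_const : ∀ m, ∀ x ∈ V m, ∃ m', ∀ y ∈ L m', x * y ∈ V m
  mul_var_var : ∀ m, ∀ x ∈ V m, ∃ m', ∀ y ∈ V m', x * y ∈ V m
  subst_const : ∀ p, ∀ x ∈ L 0, T p x = x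
  subst_var : ∀ p ≠ 0, ∀ n, p ≤ k n → ∀ m ≥ n, ∀ x ∈ V m, T p x ∈ L m

variable {k : ℕ → ℕ} {T : ℕ → M →ₙ* M} {L V : ℕ → Set M}

theorem WordTails.exists_ultrafilters (h : WordTails k T L V) :
    ∃ v ∈ ultraOf L, ∃ u ∈ ultraOf V, v * v = v ∧ u * u = u ∧ u * v = u ∧ v * u = u ∧
      ∀ p ≠ 0, ∀ n, p ≤ k n → u.map (T p) = v := by
  obtain ⟨v, hv, hvv, hmin⟩ := exists_minimal_idempotent Ultrafilter.continuous_mul_left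
    (isCompact_ultraOf L) (ultraOf_nonempty h.antitone_const h.nonempty_const)
    fun x hx y hy => mul_mem_ultraOf h.mul_const_const hx hy
  obtain ⟨u, hu, huu, huv, hvu⟩ := exists_idempotent_le Ultrafilter.continuous_mul_left
    (isCompact_ultraOf V) (ultraOf_nonempty h.antitone_var h.nonempty_var)
    (fun x hx y hy => mul_mem_ultraOf h.mul_var_var hx hy) hvv
    (fun x hx => mul_mem_ultraOf h.mul_const_var hv hx)
    (fun x hx => mul_mem_ultraOf h.mul_var_const hx hv)
  refine ⟨v, hv, u, hu, hvv, huu, huv, hvu, fun p hp n hpn => ?_⟩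
  have hTv : v.map (T p) = v := by
    refine Ultrafilter.coe_inj.mp ?_
    rw [Ultrafilter.coe_map]
    refine (Filter.map_congr ?_).trans Filter.map_id
    filter_upwards [hv 0] with x hx using h.subst_const p x hx
  refine hmin _ (fun m => ?_) ?_ ?_ ?_
  · refine Ultrafilter.mem_map.2 ?_
    filter_upwards [hu (max m n)] with x hx
    exact h.antitone_const (le_max_left m n) (h.subst_var p hp n hpn _ (le_max_right m n) x hx)
  · rw [← ultrafilter_map_mul, huu]
  · nth_rw 1 [← hTv]
    rw [← ultrafilter_map_mul, huv]
  · nth_rw 1 [← hTv]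
    rw [← ultrafilter_map_mul, hvu]

end Ultrafilter

section Construction

attribute [local instance] Ultrafilter.mul Ultrafilter.semigroup

variable {M : Type*} {k : ℕ → ℕ} {u v : Ultrafilter M}

theorem exists_word_step [Semigroup M] {T : ℕ → M →ₙ* M} (hvv : v * v = v) (huu : u * u = u)
    (huv : u * v = u) (hvu : v * u = u) {K : Set ℕ} (hK : K.Finite)
    (hT : ∀ p ∈ K, u.map (T p) = v) {A C : Set M} (hA : A ∈ u) (hC : C ∈ v) {W : M → Set M}
    (hW : ∀ x ∈ A, W x ∈ u) :
    ∃ x ∈ A, (∀ p ∈ K, T p x ∈ C) ∧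
      {y | y ∈ A ∧ y ∈ W x ∧ x * y ∈ A ∧ ∀ p ∈ K, T p x * y ∈ A} ∈ u ∧
      {y | y ∈ C ∧ x * y ∈ A ∧ ∀ p ∈ K, T p x * y ∈ C} ∈ v := by
  have hmap : ∀ p ∈ K, ∀ P : M → Prop, (∀ᶠ x in v, P x) → ∀ᶠ x in u, P (T p x) := by
    intro p hp P hP
    rw [← hT p hp] at hP
    exact hP
  have h₁ : ∀ᶠ x in u, ∀ᶠ y in u, x * y ∈ A :=
    (Ultrafilter.eventually_mul u u (· ∈ A)).1 (huu.symm ▸ hA)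
  have h₂ : ∀ᶠ x in u, ∀ᶠ y in v, x * y ∈ A :=
    (Ultrafilter.eventually_mul u v (· ∈ A)).1 (huv.symm ▸ hA)
  have h₃ : ∀ᶠ x in v, ∀ᶠ y in u, x * y ∈ A :=
    (Ultrafilter.eventually_mul v u (· ∈ A)).1 (hvu.symm ▸ hA)
  have h₄ : ∀ᶠ x in v, ∀ᶠ y in v, x * y ∈ C :=
    (Ultrafilter.eventually_mul v v (· ∈ C)).1 (hvv.symm ▸ hC)
  have h₅ := (eventually_all_finite hK).2 fun p hp => hmap p hp (· ∈ C) hC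
  have h₆ := (eventually_all_finite hK).2 fun p hp => hmap p hp _ h₃
  have h₇ := (eventually_all_finite hK).2 fun p hp => hmap p hp _ h₄
  have hA' : ∀ᶠ x in u, x ∈ A := hA
  obtain ⟨x, hx, h₁, h₂, h₅, h₆, h₇⟩ :=
    (hA'.and (h₁.and (h₂.and (h₅.and (h₆.and h₇))))).exists
  refine ⟨x, hx, h₅, ?_, ?_⟩
  · filter_upwards [hA, hW x hx, h₁, (eventually_all_finite hK).2 h₆] with y a b c d
    exact ⟨a, b, c, d⟩
  · filter_upwards [hC, h₂, (eventually_all_finite hK).2 h₇] with y a b c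
    exact ⟨a, b, c⟩

theorem exists_word_sequence [Semigroup M] {T : ℕ → M →ₙ* M} (hvv : v * v = v) (huu : u * u = u)
    (huv : u * v = u) (hvu : v * u = u)
    (hT : ∀ n, ∀ p ∈ Icc 1 (k n), u.map (T p) = v) {A C : Set M} (hA : A ∈ u) (hC : C ∈ v)
    {W : M → Set M} (hW : ∀ x ∈ A, W x ∈ u) :
    ∃ (x : ℕ → M) (𝒜 𝒞 : ℕ → Set M), 𝒜 0 = A ∧ 𝒞 0 = C ∧
      ∀ n, x n ∈ 𝒜 n ∧ (∀ p ∈ Icc 1 (k n), T p (x n) ∈ 𝒞 n) ∧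
        𝒜 (n + 1) = {y | y ∈ 𝒜 n ∧ y ∈ W (x n) ∧ x n * y ∈ 𝒜 n ∧
          ∀ p ∈ Icc 1 (k n), T p (x n) * y ∈ 𝒜 n} ∧
        𝒞 (n + 1) = {y | y ∈ 𝒞 n ∧ x n * y ∈ 𝒜 n ∧
          ∀ p ∈ Icc 1 (k n), T p (x n) * y ∈ 𝒞 n} := by
  let σ := {q : Set M × Set M // q.1 ∈ u ∧ q.2 ∈ v ∧ q.1 ⊆ A}
  have step (n : ℕ) (q : σ) := exists_word_step hvv huu huv hvu (finite_Icc 1 (k n)) (hT n)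
    q.2.1 q.2.2.1 (W := W) fun x hx => hW x (q.2.2.2 hx)
  choose f hf hfT hfA hfC using step
  let next (n : ℕ) (q : σ) : σ := ⟨(_, _), hfA n q, hfC n q, fun y hy => q.2.2.2 hy.1⟩
  let seq : ℕ → σ := Nat.rec ⟨(A, C), hA, hC, Subset.rfl⟩ next
  exact ⟨fun n => f n (seq n), fun n => (seq n).1.1, fun n => (seq n).1.2, rfl, rfl,
    fun n => ⟨hf n (seq n), hfT n (seq n), rfl, rfl⟩⟩

/-- The product of the words `T p (x n)` over a list of pairs `(n, p)`. -/
def substProd [Monoid M] (T : ℕ → M → M) (x : ℕ → M) (l : List (ℕ × ℕ)) : M :=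
  (l.map fun q => T q.2 (x q.1)).prod

theorem exists_homogeneous_sequence [Monoid M] {T : ℕ → M →ₙ* M} (hT0 : ∀ x, T 0 x = x)
    (hvv : v * v = v) (huu : u * u = u) (huv : u * v = u) (hvu : v * u = u)
    (hT : ∀ n, ∀ p ∈ Icc 1 (k n), u.map (T p) = v) {A C : Set M} (hA : A ∈ u) (hC : C ∈ v)
    {W : M → Set M} (hW : ∀ x ∈ A, W x ∈ u) :
    ∃ x : ℕ → M, (∀ n, x n ∈ A) ∧ (∀ n, x (n + 1) ∈ W (x n)) ∧
      ∀ l : List (ℕ × ℕ), l ≠ [] → l.Pairwise (fun a b => a.1 < b.1) → (∀ q ∈ l, q.2 ≤ k q.1) →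
        ((∃ q ∈ l, q.2 = 0) → substProd (fun p => T p) x l ∈ A) ∧
        ((∀ q ∈ l, q.2 ≠ 0) → substProd (fun p => T p) x l ∈ C) := by
  obtain ⟨x, 𝒜, 𝒞, hA0, hC0, h⟩ := exists_word_sequence hvv huu huv hvu hT hA hC hW
  have hAanti : Antitone 𝒜 := antitone_nat_of_succ_le fun n => by
    rw [(h n).2.2.1]; exact fun y hy => hy.1
  have hCanti : Antitone 𝒞 := antitone_nat_of_succ_le fun n => by
    rw [(h n).2.2.2]; exact fun y hy => hy.1
  have key : ∀ l : List (ℕ × ℕ), l ≠ [] → l.Pairwise (fun a b => a.1 < b.1) →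
      (∀ q ∈ l, q.2 ≤ k q.1) → ∀ m, (∀ q ∈ l, m ≤ q.1) →
        ((∃ q ∈ l, q.2 = 0) → substProd (fun p => T p) x l ∈ 𝒜 m) ∧
        ((∀ q ∈ l, q.2 ≠ 0) → substProd (fun p => T p) x l ∈ 𝒞 m) := by
    intro l
    induction l with
    | nil => simp
    | cons q l ih =>
      obtain ⟨n, p⟩ := q
      intro _ hl hk m hm
      have hmn : m ≤ n := hm (n, p) (by simp)
      have hpk : p ≤ k n := hk (n, p) (by simp)
      obtain ⟨hxA, hxC, hA', hC'⟩ := h n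
      rw [List.pairwise_cons] at hl
      rcases eq_or_ne l [] with rfl | hne
      · rcases Nat.eq_zero_or_pos p with rfl | hp
        · simpa [substProd, hT0] using hAanti hmn hxA
        · simpa [substProd, hp.ne'] using hCanti hmn (hxC p ⟨hp, hpk⟩)
      · obtain ⟨ihA, ihC⟩ := ih hne hl.2 (fun q hq => hk q (by simp [hq])) (n + 1) hl.1
        have hprod : substProd (fun p => T p) x ((n, p) :: l) =
            T p (x n) * substProd (fun p => T p) x l := by simp [substProd]
        rw [hprod]
        refine ⟨fun h0 => hAanti hmn ?_, fun h0 => hCanti hmn ?_⟩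
        · rcases Nat.eq_zero_or_pos p with rfl | hp
          · rw [hT0]
            by_cases hl0 : ∃ q ∈ l, q.2 = 0
            · exact (hA' ▸ ihA hl0).2.2.1
            · push Not at hl0
              exact (hC' ▸ ihC hl0).2.1
          · refine (hA' ▸ ihA ?_).2.2.2 p ⟨hp, hpk⟩
            simpa [hp.ne'] using h0
        · have hp : p ≠ 0 := h0 (n, p) (by simp)
          exact (hC' ▸ ihC fun q hq => h0 q (by simp [hq])).2.2 p ⟨Nat.pos_of_ne_zero hp, hpk⟩
  refine ⟨x, fun n => hA0 ▸ hAanti (Nat.zero_le n) (h n).1, fun n => ?_, fun l hl hs hk => ?_⟩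
  · have := (h (n + 1)).1
    rw [(h n).2.2.1] at this
    exact this.2.1
  · rw [← hA0, ← hC0]
    exact key l hl hs hk 0 fun q _ => Nat.zero_le _

end Construction

section LocatedWords

/-- Located words form a monoid under `star`, with unit the empty word. -/
@[reducible] def starMonoid : Monoid LWord where
  mul := star
  one := emptyW
  mul_assoc a b c := by
    funext n
    change ((a n).orElse fun _ => b n).orElse (fun _ => c n) =
      (a n).orElse fun _ => (b n).orElse fun _ => c n
    cases a n <;> rfl
  one_mul a := rfl
  mul_one a := by
    funext n
    change (a n).orElse (fun _ => none) = a n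
    cases a n <;> rfl

attribute [local instance] starMonoid

theorem mul_apply_of_none {a : LWord} (b : LWord) {n : ℕ} (h : a n = none) :
    (a * b) n = b n := by
  change (a n).orElse (fun _ => b n) = b n
  rw [h]; rfl

theorem mul_apply_of_some {a : LWord} (b : LWord) {n c : ℕ} (h : a n = some c) :
    (a * b) n = some c := by
  change (a n).orElse (fun _ => b n) = some c
  rw [h]; rfl

theorem one_word_apply (n : ℕ) : (1 : LWord) n = none := rfl

/-- The substitution `Tp k p` as a homomorphism for concatenation. -/
def substHom (k : ℕ → ℕ) (p : ℕ) : LWord →ₙ* LWord where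
  toFun := Tp k p
  map_mul' a b := by
    funext n
    rcases h : a n with _ | c
    · have h' : Tp k p a n = none := by simp [Tp, h]
      rw [mul_apply_of_none _ h', Tp, mul_apply_of_none _ h, Tp]
    · have h' : Tp k p a n = some (if c = 0 ∧ p ≠ 0 then min p (k n) else c) := by
        simp only [Tp, h]; split_ifs <;> rfl
      rw [mul_apply_of_some _ h', Tp, mul_apply_of_some _ h]
      split_ifs <;> simp_all

variable {k : ℕ → ℕ}

theorem Tp_zero (a : LWord) : Tp k 0 a = a := by
  funext n
  simp only [Tp]
  cases a n <;> simp

theorem Tp_eq_none_iff {p : ℕ} {a : LWord} {n : ℕ} : Tp k p a n = none ↔ a n = none := by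
  simp only [Tp]
  cases a n
  · simp
  · simp only [reduceCtorEq, iff_false]; split_ifs <;> simp

theorem Tp_le {p : ℕ} {a : LWord} (ha : ∀ n c, a n = some c → c ≤ k n) {n c : ℕ}
    (h : Tp k p a n = some c) : c ≤ k n := by
  simp only [Tp] at h
  rcases hn : a n with _ | d
  · simp [hn] at h
  · simp only [hn] at h
    have := ha n d hn
    split_ifs at h <;> simp at h <;> omega

theorem one_le_of_Tp (hk : ∀ n, 0 < k n) {p : ℕ} (hp : p ≠ 0) {a : LWord} {n c : ℕ}
    (h : Tp k p a n = some c) : 1 ≤ c := by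
  have := hk n
  simp only [Tp] at h
  rcases hn : a n with _ | d
  · simp [hn] at h
  · simp only [hn] at h
    split_ifs at h <;> simp at h <;> omega

theorem Tp_eq_self {p : ℕ} {a : LWord} (ha : ∀ n c, a n = some c → 1 ≤ c) : Tp k p a = a := by
  funext n
  simp only [Tp]
  rcases hn : a n with _ | d
  · rfl
  · have := ha n d hn
    simp only
    rw [if_neg (by omega)]

/-- The word `T_{p₁}(w_{n₁}) ⋆ ⋯ ⋆ T_{p_l}(w_{n_l})` of a list of pairs `(nᵢ, pᵢ)`. -/
abbrev combList (k : ℕ → ℕ) (w : ℕ → LWord) (l : List (ℕ × ℕ)) : LWord :=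
  substProd (Tp k) w l

variable {w : ℕ → LWord}

theorem combList_cons (q : ℕ × ℕ) (l : List (ℕ × ℕ)) :
    combList k w (q :: l) = Tp k q.2 (w q.1) * combList k w l := by
  simp [combList, substProd]

theorem combList_append (l l' : List (ℕ × ℕ)) :
    combList k w (l ++ l') = combList k w l * combList k w l' := by
  simp [combList, substProd]

theorem comb_eq_combList {l : ℕ} (n p : Fin (l + 1) → ℕ) :
    comb k w n p = combList k w (List.ofFn fun i => (n i, p i)) := by
  rw [combList, substProd, List.map_ofFn]
  rfl

theorem combList_eq_some {l : List (ℕ × ℕ)} {n c : ℕ} (h : combList k w l n = some c) :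
    ∃ q ∈ l, Tp k q.2 (w q.1) n = some c := by
  induction l with
  | nil => exact absurd h (by simp [combList, substProd, one_word_apply])
  | cons q l ih =>
    rw [combList_cons] at h
    rcases hq : Tp k q.2 (w q.1) n with _ | d
    · rw [mul_apply_of_none _ hq] at h
      obtain ⟨q', hq', h'⟩ := ih h
      exact ⟨q', by simp [hq'], h'⟩
    · rw [mul_apply_of_some _ hq] at h
      exact ⟨q, by simp, hq.trans h⟩

theorem combList_ne_none_iff {l : List (ℕ × ℕ)} {n : ℕ} :
    combList k w l n ≠ none ↔ ∃ q ∈ l, w q.1 n ≠ none := by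
  induction l with
  | nil => simp [combList, substProd, one_word_apply]
  | cons q l ih =>
    rw [combList_cons]
    rcases hq : w q.1 n with _ | d
    · rw [mul_apply_of_none _ (Tp_eq_none_iff.2 hq), ih]
      simp [hq]
    · obtain ⟨c, hc⟩ := Option.ne_none_iff_exists'.1
        (fun h => by simp [Tp_eq_none_iff, hq] at h : Tp k q.2 (w q.1) n ≠ none)
      rw [mul_apply_of_some _ hc]
      simp [hq]

theorem OrderlyVar.wlt_of_lt (hw : OrderlyVar k w) {i j : ℕ} (hij : i < j) :
    wlt (w i) (w j) := by
  induction j, hij using Nat.le_induction with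
  | base => exact hw.2 i
  | succ j _ ih =>
    intro m n hm hn
    obtain ⟨x, hx⟩ := (hw.1 j).2.1
    exact (ih m x hm hx).trans (hw.2 j x n hx hn)

theorem dom_combList_finite (hw : OrderlyVar k w) (l : List (ℕ × ℕ)) :
    (dom (combList k w l)).Finite := by
  refine (l.finite_toSet.biUnion fun q _ => (hw.1 q.1).1).subset fun n hn => ?_
  simpa [dom] using combList_ne_none_iff.1 hn

theorem dom_combList_nonempty (hw : OrderlyVar k w) {l : List (ℕ × ℕ)} (hl : l ≠ []) :
    (dom (combList k w l)).Nonempty := by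
  obtain ⟨q, hq⟩ := List.exists_mem_of_ne_nil l hl
  obtain ⟨n, hn⟩ := (hw.1 q.1).2.1
  exact ⟨n, combList_ne_none_iff.2 ⟨q, hq, hn⟩⟩

theorem combList_le (hw : OrderlyVar k w) {l : List (ℕ × ℕ)} {n c : ℕ}
    (h : combList k w l n = some c) : c ≤ k n := by
  obtain ⟨q, -, hq⟩ := combList_eq_some h
  exact Tp_le (hw.1 q.1).2.2.1 hq

theorem one_le_of_combList (hk : ∀ n, 0 < k n) {l : List (ℕ × ℕ)} (hl : ∀ q ∈ l, q.2 ≠ 0)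
    {n c : ℕ} (h : combList k w l n = some c) : 1 ≤ c := by
  obtain ⟨q, hq, h⟩ := combList_eq_some h
  exact one_le_of_Tp hk (hl q hq) h

theorem exists_combList_eq_zero (hw : OrderlyVar k w) {l : List (ℕ × ℕ)}
    (hl : l.Pairwise fun a b => a.1 < b.1) (h0 : ∃ q ∈ l, q.2 = 0) :
    ∃ n, combList k w l n = some 0 := by
  induction l with
  | nil => simp at h0
  | cons q l ih =>
    rw [List.pairwise_cons] at hl
    by_cases hq : q.2 = 0
    · obtain ⟨n, hn⟩ := (hw.1 q.1).2.2.2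
      refine ⟨n, ?_⟩
      rw [combList_cons]
      exact mul_apply_of_some _ (by rw [hq, Tp_zero, hn])
    · obtain ⟨n, hn⟩ := ih hl.2 (by simpa [hq] using h0)
      refine ⟨n, ?_⟩
      obtain ⟨q', hq', hn'⟩ := combList_ne_none_iff.1 (by simp [hn] : combList k w l n ≠ none)
      have : w q.1 n = none := by
        by_contra hne
        exact (hw.wlt_of_lt (hl.1 q' hq') n n hne hn').false
      rw [combList_cons, mul_apply_of_none _ (Tp_eq_none_iff.2 this), hn]

/-- The lists of pairs `(n, p)` with increasing `n ≥ m` and `p ≤ k n`. -/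
def Admissible (k : ℕ → ℕ) (m : ℕ) (l : List (ℕ × ℕ)) : Prop :=
  l.Pairwise (fun a b => a.1 < b.1) ∧ ∀ q ∈ l, m ≤ q.1 ∧ q.2 ≤ k q.1

/-- The words of `E(w⃗)` using only the terms of `w⃗` from the `m`-th on. -/
def constTail (k : ℕ → ℕ) (w : ℕ → LWord) (m : ℕ) : Set LWord :=
  combList k w '' {l | Admissible k m l ∧ l ≠ [] ∧ ∀ q ∈ l, q.2 ≠ 0}

/-- The words of `EV(w⃗)` using only the terms of `w⃗` from the `m`-th on. -/
def varTail (k : ℕ → ℕ) (w : ℕ → LWord) (m : ℕ) : Set LWord :=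
  combList k w '' {l | Admissible k m l ∧ ∃ q ∈ l, q.2 = 0}

theorem Admissible.mono {m m' : ℕ} (h : m ≤ m') {l : List (ℕ × ℕ)} (hl : Admissible k m' l) :
    Admissible k m l :=
  ⟨hl.1, fun q hq => ⟨h.trans (hl.2 q hq).1, (hl.2 q hq).2⟩⟩

theorem Admissible.exists_append {m : ℕ} {l : List (ℕ × ℕ)} (hl : Admissible k m l) :
    ∃ m', ∀ l', Admissible k m' l' → Admissible k m (l ++ l') := by
  obtain ⟨B, hB⟩ : ∃ B, ∀ q ∈ l, q.1 < B := by
    obtain ⟨B, hB⟩ := (l.finite_toSet.image Prod.fst).bddAbove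
    exact ⟨B + 1, fun q hq => Nat.lt_succ_of_le (hB ⟨q, hq, rfl⟩)⟩
  refine ⟨max m B, fun l' hl' => ⟨List.pairwise_append.2 ⟨hl.1, hl'.1, fun a ha b hb =>
    (hB a ha).trans_le ((le_max_right _ _).trans (hl'.2 b hb).1)⟩, fun q hq => ?_⟩⟩
  rcases List.mem_append.1 hq with hq | hq
  · exact hl.2 q hq
  · exact (hl'.mono (le_max_left m B)).2 q hq

theorem substHom_combList (hk : ∀ n, 0 < k n) (p : ℕ) (l : List (ℕ × ℕ)) :
    substHom k p (combList k w l) =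
      combList k w (l.map fun q => (q.1, if q.2 = 0 then p else q.2)) := by
  have hT (q : ℕ × ℕ) :
      Tp k p (Tp k q.2 (w q.1)) = Tp k (if q.2 = 0 then p else q.2) (w q.1) := by
    split_ifs with h
    · rw [h, Tp_zero]
    · exact Tp_eq_self fun n c hc => one_le_of_Tp hk h hc
  induction l with
  | nil => rfl
  | cons q l ih => rw [List.map_cons, combList_cons, combList_cons, map_mul, ih, ← hT]; rfl

theorem wordTails (hk : ∀ n, 0 < k n) (hmono : Monotone k) :
    WordTails k (substHom k) (constTail k w) (varTail k w) where
  antitone_const m m' h := image_mono fun l hl => ⟨hl.1.mono h, hl.2⟩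
  antitone_var m m' h := image_mono fun l hl => ⟨hl.1.mono h, hl.2⟩
  nonempty_const m :=
    have hm : 1 ≤ k m := hk m
    ⟨_, [(m, 1)], ⟨⟨by simp, by simpa using hm⟩, by simp, by simp⟩, rfl⟩
  nonempty_var m := ⟨_, [(m, 0)], ⟨⟨by simp, by simp⟩, by simp⟩, rfl⟩
  mul_const_const := by
    rintro m _ ⟨l, ⟨hl, hne, h0⟩, rfl⟩
    obtain ⟨m', hm'⟩ := hl.exists_append
    refine ⟨m', ?_⟩
    rintro _ ⟨l', ⟨hl', hne', h0'⟩, rfl⟩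
    refine ⟨l ++ l', ⟨hm' l' hl', by simp [hne], fun q hq => ?_⟩, combList_append l l'⟩
    exact (List.mem_append.1 hq).elim (h0 q) (h0' q)
  mul_const_var := by
    rintro m _ ⟨l, ⟨hl, hne, h0⟩, rfl⟩
    obtain ⟨m', hm'⟩ := hl.exists_append
    refine ⟨m', ?_⟩
    rintro _ ⟨l', ⟨hl', q, hq, h0'⟩, rfl⟩
    exact ⟨l ++ l', ⟨hm' l' hl', q, by simp [hq], h0'⟩, combList_append l l'⟩
  mul_var_const := by
    rintro m _ ⟨l, ⟨hl, q, hq, h0⟩, rfl⟩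
    obtain ⟨m', hm'⟩ := hl.exists_append
    refine ⟨m', ?_⟩
    rintro _ ⟨l', ⟨hl', -, -⟩, rfl⟩
    exact ⟨l ++ l', ⟨hm' l' hl', q, by simp [hq], h0⟩, combList_append l l'⟩
  mul_var_var := by
    rintro m _ ⟨l, ⟨hl, q, hq, h0⟩, rfl⟩
    obtain ⟨m', hm'⟩ := hl.exists_append
    refine ⟨m', ?_⟩
    rintro _ ⟨l', ⟨hl', -⟩, rfl⟩
    exact ⟨l ++ l', ⟨hm' l' hl', q, by simp [hq], h0⟩, combList_append l l'⟩
  subst_const := by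
    rintro p _ ⟨l, ⟨-, -, h0⟩, rfl⟩
    exact Tp_eq_self fun n c hc => one_le_of_combList hk h0 hc
  subst_var := by
    rintro p hp n hpn m hm _ ⟨l, ⟨hl, q, hq, -⟩, rfl⟩
    have hne : l ≠ [] := List.ne_nil_of_mem hq
    rw [substHom_combList hk p l]
    refine mem_image_of_mem _ ⟨⟨List.pairwise_map.2 hl.1, ?_⟩, by simpa using hne, ?_⟩
    · simp only [List.mem_map, forall_exists_index, and_imp, forall_apply_eq_imp_iff₂]
      intro q hq
      obtain ⟨h₁, h₂⟩ := hl.2 q hq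
      refine ⟨h₁, ?_⟩
      split_ifs
      · exact hpn.trans (hmono (hm.trans h₁))
      · exact h₂
    · simp only [List.mem_map, forall_exists_index, and_imp, forall_apply_eq_imp_iff₂]
      intro q hq
      split_ifs with h
      · exact hp
      · exact h

theorem varTail_zero_subset_EV : varTail k w 0 ⊆ EV k w := by
  rintro _ ⟨l, ⟨hl, h0⟩, rfl⟩
  cases l with
  | nil => simp at h0
  | cons a t =>
    refine ⟨t.length, fun i => ((a :: t).get i).1, fun i => ((a :: t).get i).2,
      fun i j hij => List.pairwise_iff_get.1 hl.1 i j hij,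
      fun i => (hl.2 _ (List.get_mem (a :: t) i)).2, ?_, ?_⟩
    · obtain ⟨q, hq, h0⟩ := h0
      obtain ⟨i, rfl⟩ := List.get_of_mem hq
      exact ⟨i, h0⟩
    · rw [comb_eq_combList]
      exact congrArg _ (List.ofFn_get (a :: t)).symm

theorem isVarWord_of_mem_varTail (hw : OrderlyVar k w) {m : ℕ} {a : LWord}
    (ha : a ∈ varTail k w m) : IsVarWord k a := by
  obtain ⟨l, ⟨hl, h0⟩, rfl⟩ := ha
  obtain ⟨q, hq, -⟩ := id h0
  exact ⟨dom_combList_finite hw l, dom_combList_nonempty hw (List.ne_nil_of_mem hq),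
    fun n c hc => combList_le hw hc, exists_combList_eq_zero hw hl.1 h0⟩

theorem isConstWord_of_mem_constTail (hk : ∀ n, 0 < k n) (hw : OrderlyVar k w) {m : ℕ}
    {a : LWord} (ha : a ∈ constTail k w m) : IsConstWord k a := by
  obtain ⟨l, ⟨-, hne, h0⟩, rfl⟩ := ha
  exact ⟨dom_combList_finite hw l, dom_combList_nonempty hw hne,
    fun n c hc => ⟨one_le_of_combList hk h0 hc, combList_le hw hc⟩⟩

theorem exists_varTail_wlt (hw : OrderlyVar k w) {a : LWord} (ha : a ∈ varTail k w 0) :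
    ∃ m, ∀ b ∈ varTail k w m, wlt a b := by
  obtain ⟨l, ⟨hl, -⟩, rfl⟩ := ha
  obtain ⟨B, hB⟩ := (l.finite_toSet.image Prod.fst).bddAbove
  refine ⟨B + 1, ?_⟩
  rintro _ ⟨l', ⟨hl', -⟩, rfl⟩ m n hm hn
  obtain ⟨q, hq, hm⟩ := combList_ne_none_iff.1 hm
  obtain ⟨q', hq', hn⟩ := combList_ne_none_iff.1 hn
  exact hw.wlt_of_lt ((Nat.lt_succ_of_le (hB ⟨q, hq, rfl⟩)).trans_le (hl'.2 q' hq').1) m n hm hn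

theorem pairwise_ofFn_of_strictMono {l : ℕ} {n : Fin (l + 1) → ℕ} (hn : StrictMono n)
    (p : Fin (l + 1) → ℕ) :
    (List.ofFn fun i => (n i, p i)).Pairwise fun a b => a.1 < b.1 :=
  List.pairwise_ofFn.2 fun _ _ hij => hn hij

end LocatedWords

end Auxiliary

/-- **Theorem 1.2**: given an infinite orderly sequence `w⃗` of variable ω-located words and
finite partitions of `L(Σ,k⃗;υ)` and `L(Σ,k⃗)`, there is an extraction `u⃗ ≺ w⃗` with
`EV(u⃗)` monochromatic and `E(u⃗)` monochromatic. -/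
theorem partition_extraction
    (k : ℕ → ℕ) (hk : ∀ n, 0 < k n) (hmono : Monotone k)
    (w : ℕ → LWord) (hw : OrderlyVar k w)
    (r s : ℕ) (hr : 0 < r) (hs : 0 < s)
    (A : Fin r → Set LWord) (C : Fin s → Set LWord)
    (hA : ∀ v, IsVarWord k v → ∃ i, v ∈ A i)
    (hC : ∀ v, IsConstWord k v → ∃ j, v ∈ C j) :
    ∃ u : ℕ → LWord, Extraction k u w ∧
      ∃ (i₀ : Fin r) (j₀ : Fin s), EV k u ⊆ A i₀ ∧ Econst k u ⊆ C j₀ := by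
  let := starMonoid
  let : Semigroup (Ultrafilter LWord) := Ultrafilter.semigroup
  obtain ⟨v, hv, u, hu, hvv, huu, huv, hvu, hT⟩ :=
    (wordTails (w := w) hk hmono).exists_ultrafilters
  obtain ⟨i₀, hi₀⟩ : ∃ i, ∀ᶠ x in u, x ∈ A i := by
    refine Ultrafilter.eventually_exists_iff.1 ?_
    filter_upwards [hu 0] with x hx using hA x (isVarWord_of_mem_varTail hw hx)
  obtain ⟨j₀, hj₀⟩ : ∃ j, ∀ᶠ x in v, x ∈ C j := by
    refine Ultrafilter.eventually_exists_iff.1 ?_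
    filter_upwards [hv 0] with x hx using hC x (isConstWord_of_mem_constTail hk hw hx)
  obtain ⟨x, hxA, hxW, hx⟩ := exists_homogeneous_sequence (T := substHom k) Tp_zero hvv huu huv hvu
    (fun n p hp => hT p (Nat.one_le_iff_ne_zero.1 hp.1) n hp.2)
    (Filter.inter_mem hi₀ (hu 0)) hj₀ (W := fun a => {b | wlt a b}) fun a ha => by
      obtain ⟨m, hm⟩ := exists_varTail_wlt hw ha.2
      exact Filter.mem_of_superset (hu m) hm
  refine ⟨x, ⟨⟨fun n => isVarWord_of_mem_varTail hw (hxA n).2, hxW⟩,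
    fun n => varTail_zero_subset_EV (hxA n).2⟩, i₀, j₀, ?_, ?_⟩
  · rintro _ ⟨l, n, p, hn, hp, ⟨i, hi⟩, rfl⟩
    rw [comb_eq_combList]
    refine ((hx _ (by simp) (pairwise_ofFn_of_strictMono hn p) ?_).1 ?_).1
    · exact List.forall_mem_ofFn_iff.2 hp
    · exact ⟨_, List.mem_ofFn.2 ⟨i, rfl⟩, hi⟩
  · rintro _ ⟨l, n, p, hn, hp, rfl⟩
    rw [comb_eq_combList]
    refine (hx _ (by simp) (pairwise_ofFn_of_strictMono hn p) ?_).2 ?_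
    · exact List.forall_mem_ofFn_iff.2 fun i => (hp i).2
    · exact List.forall_mem_ofFn_iff.2 fun i => Nat.one_le_iff_ne_zero.1 (hp i).1

end Farmaki
end
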